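/- Let K be a locally compact Hausdorff topological space which is not σ-compact and such that every countable family of compact subsets of K is contained in a single compact subset of K. Then the closed unit ball of C₀(K) is totally bounded with respect to every seminorm ν_{X,Φ} associated to an external admissible system X = (xᵢ)_{i∈ℕ} ⊆ C_b(K) for C₀(K) and a sequence Φ = (φ_k)_{k∈ℕ} of states on C₀(K): for every such (X, Φ) and every ε > 0 there exist finitely many elements y₁, …, yₙ of the unit ball of C₀(K) such that for every x in the unit ball of C₀(K) there is some j with ν_{X,Φ}(x − y_j) < ε, where ν_{X,Φ}(x)² = sup_k ∑_{i=k}^∞ |φ_k(x̄·xᵢ)|². -/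

import Mathlib

open scoped ZeroAtInfty BoundedContinuousFunction ComplexOrder
open Filter

/-- The `C₀(K)`-valued inner product `⟨x, y⟩ = x̄·y` of `x ∈ C₀(K)` with a multiplier
`y ∈ C_b(K)`. -/
noncomputable def mulIP {K : Type*} [TopologicalSpace K]
    (x : C₀(K, ℂ)) (y : K →ᵇ ℂ) : C₀(K, ℂ) where
  toFun := fun t => star (x t) * y t
  continuous_toFun := ((map_continuous x).star).mul y.continuous
  zero_at_infty' := by
    have htend : Tendsto (fun t => ‖x t‖ * ‖y‖) (cocompact K) (nhds 0) := by
      have hx : Tendsto (fun t => ‖x t‖) (cocompact K) (nhds 0) := by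
        simpa using (x.zero_at_infty').norm
      simpa using hx.mul_const ‖y‖
    refine squeeze_zero_norm (fun t => ?_) htend
    calc ‖star (x t) * y t‖ ≤ ‖star (x t)‖ * ‖y t‖ := norm_mul_le _ _
      _ ≤ ‖x t‖ * ‖y‖ := by
          rw [norm_star]
          exact mul_le_mul_of_nonneg_left (y.norm_coe_le_norm t) (norm_nonneg _)

/-- A sequence `X` in `C_b(K)` is an external admissible system for `C₀(K)` if:
(1) for every `x ∈ C₀(K)` the series `∑ᵢ |xᵢ|²|x|²` converges uniformly;
(2) its sum is bounded pointwise by `|x|²`; (3) `‖xᵢ‖ ≤ 1` for all `i`. -/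
def IsExternalAdmissible {K : Type*} [TopologicalSpace K] (X : ℕ → (K →ᵇ ℂ)) : Prop :=
  (∀ x : C₀(K, ℂ), ∃ g : K → ℝ,
      TendstoUniformly
        (fun n (t : K) => ∑ i ∈ Finset.range n, ‖X i t‖ ^ 2 * ‖x t‖ ^ 2) g atTop ∧
      ∀ t : K, g t ≤ ‖x t‖ ^ 2) ∧
  ∀ i, ‖X i‖ ≤ 1

/-- A state on `C₀(K)`: a positive continuous linear functional of norm one. -/
def IsStateC0 {K : Type*} [TopologicalSpace K] (φ : C₀(K, ℂ) →L[ℂ] ℂ) : Prop :=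
  (∀ f : C₀(K, ℂ), (∀ t : K, 0 ≤ f t) → 0 ≤ φ f) ∧ ‖φ‖ = 1

/-- The seminorm `ν_{X,Φ}`, with `ν_{X,Φ}(x)² = sup_k ∑_{i=k}^∞ |φ_k(⟨x, xᵢ⟩)|²`. -/
noncomputable def nuXPhi {K : Type*} [TopologicalSpace K]
    (X : ℕ → (K →ᵇ ℂ)) (φ : ℕ → (C₀(K, ℂ) →L[ℂ] ℂ)) (x : C₀(K, ℂ)) : ℝ :=
  Real.sqrt (⨆ k : ℕ, ∑' i : ℕ, ‖φ k (mulIP x (X (k + i)))‖ ^ 2)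

theorem c0_norm_le {K : Type*} [TopologicalSpace K] (f : C₀(K, ℂ)) {c : ℝ} (hc : 0 ≤ c)
    (h : ∀ t, ‖f t‖ ≤ c) : ‖f‖ ≤ c := by
  rw [← ZeroAtInftyContinuousMap.norm_toBCF_eq_norm]
  exact (BoundedContinuousFunction.norm_le hc).2 h

theorem c0_apply_le {K : Type*} [TopologicalSpace K] (f : C₀(K, ℂ)) (t : K) : ‖f t‖ ≤ ‖f‖ := by
  rw [← ZeroAtInftyContinuousMap.norm_toBCF_eq_norm]
  exact f.toBCF.norm_coe_le_norm t

theorem c0_sum_apply {K : Type*} [TopologicalSpace K] (s : Finset ℕ) (f : ℕ → C₀(K, ℂ)) (t : K) :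
    (∑ i ∈ s, f i) t = ∑ i ∈ s, f i t := by
  classical
  induction s using Finset.induction_on with
  | empty => simp
  | insert a s ha ih => simp [Finset.sum_insert ha, ih]

theorem mulIP_apply' {K : Type*} [TopologicalSpace K] (x : C₀(K, ℂ)) (y : K →ᵇ ℂ) (t : K) :
    mulIP x y t = star (x t) * y t := rfl

theorem mulIP_sub' {K : Type*} [TopologicalSpace K] (x x' : C₀(K, ℂ)) (y : K →ᵇ ℂ) :
    mulIP (x - x') y = mulIP x y - mulIP x' y := by
  ext t
  simp [mulIP_apply', sub_mul]

/-- Values on disjointly supported elements of the unit ball add up to at most `1`. -/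
theorem disjoint_sum_le {K : Type*} [TopologicalSpace K] (φ : C₀(K, ℂ) →L[ℂ] ℂ) (hφ : ‖φ‖ ≤ 1)
    (f h : C₀(K, ℂ)) (hf : ‖f‖ ≤ 1) (hh : ‖h‖ ≤ 1) (hd : ∀ t, f t = 0 ∨ h t = 0) :
    ‖φ f‖ + ‖φ h‖ ≤ 1 := by
  obtain ⟨a, ha, ha'⟩ := RCLike.exists_norm_eq_mul_self (φ f)
  obtain ⟨b, hb, hb'⟩ := RCLike.exists_norm_eq_mul_self (φ h)
  have h1 : ‖a • f + b • h‖ ≤ 1 := by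
    refine c0_norm_le _ zero_le_one fun t => ?_
    have h2 := (c0_apply_le f t).trans hf
    have h3 := (c0_apply_le h t).trans hh
    rcases hd t with h0 | h0 <;> simp [h0, ha, hb, h2, h3]
  have h4 : φ (a • f + b • h) = ((‖φ f‖ + ‖φ h‖ : ℝ) : ℂ) := by
    rw [map_add, map_smul, map_smul, smul_eq_mul, smul_eq_mul, Complex.ofReal_add]
    exact congrArg₂ (· + ·) ha'.symm hb'.symm
  have h5 : ‖φ (a • f + b • h)‖ ≤ 1 := by
    refine (φ.le_opNorm _).trans ?_
    exact mul_le_one₀ hφ (norm_nonneg _) h1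
  rw [h4, Complex.norm_real, Real.norm_eq_abs] at h5
  exact (le_abs_self _).trans h5

theorem phi_eq_zero {K : Type*} [TopologicalSpace K] (φ : C₀(K, ℂ) →L[ℂ] ℂ) (hφ : ‖φ‖ ≤ 1)
    (C : Set K) (f : ℕ → C₀(K, ℂ)) (hf : ∀ n, ‖f n‖ ≤ 1)
    (hfφ : ∀ n : ℕ, 1 - 1 / ((n : ℝ) + 1) < ‖φ (f n)‖) (hfC : ∀ n, ∀ t ∉ C, f n t = 0)
    (h : C₀(K, ℂ)) (hh : ∀ t ∈ C, h t = 0) : φ h = 0 := by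
  have hM : 0 < ‖h‖ + 1 := by positivity
  set c : ℂ := (((‖h‖ + 1)⁻¹ : ℝ) : ℂ) with hc
  have hc0 : c ≠ 0 := by rw [hc]; exact_mod_cast (inv_pos.2 hM).ne'
  have hn : ‖c • h‖ ≤ 1 := by
    rw [norm_smul, hc, Complex.norm_real, Real.norm_of_nonneg (inv_pos.2 hM).le,
      inv_mul_le_iff₀ hM]
    linarith
  have key : ∀ n : ℕ, ‖φ (c • h)‖ ≤ 1 / ((n : ℝ) + 1) := by
    intro n
    have := disjoint_sum_le φ hφ (f n) (c • h) (hf n) hn (fun t => by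
      by_cases ht : t ∈ C
      · right; simp [hh t ht]
      · left; exact hfC n t ht)
    linarith [hfφ n]
  have h0 : ‖φ (c • h)‖ ≤ 0 :=
    ge_of_tendsto' tendsto_one_div_add_atTop_nhds_zero_nat key
  have h1 : c * φ h = 0 := by
    rw [← smul_eq_mul, ← map_smul]; exact norm_le_zero_iff.1 h0
  exact (mul_eq_zero.1 h1).resolve_left hc0

theorem bessel_bound {K : Type*} [TopologicalSpace K] (φ : C₀(K, ℂ) →L[ℂ] ℂ) (hφ : ‖φ‖ ≤ 1)
    (e : C₀(K, ℂ)) (he : ∀ F : C₀(K, ℂ), φ F = φ (F * e))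
    (X : ℕ → (K →ᵇ ℂ)) (s : Finset ℕ) (D R : ℝ) (hR : 0 ≤ R) (hD : 0 ≤ D)
    (hs : ∀ t, ∑ i ∈ s, ‖X i t‖ ^ 2 * ‖e t‖ ^ 2 ≤ D) (x : C₀(K, ℂ)) (hx : ‖x‖ ≤ R) :
    ∑ i ∈ s, ‖φ (mulIP x (X i))‖ ^ 2 ≤ R ^ 2 * D := by
  set A := ∑ i ∈ s, ‖φ (mulIP x (X i))‖ ^ 2 with hA
  have hA0 : 0 ≤ A := Finset.sum_nonneg fun i _ => by positivity
  set F : C₀(K, ℂ) := ∑ i ∈ s, (star (φ (mulIP x (X i)))) • mulIP x (X i) with hF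
  have hφF : φ F = (A : ℂ) := by
    rw [hF, map_sum, hA, Complex.ofReal_sum]
    refine Finset.sum_congr rfl fun i _ => ?_
    rw [map_smul, smul_eq_mul, Complex.star_def, Complex.conj_mul', Complex.ofReal_pow]
  have hpt : ∀ t, ‖(F * e) t‖ ^ 2 ≤ A * (R ^ 2 * D) := by
    intro t
    have h1 : ‖(F * e) t‖ ≤ ∑ i ∈ s, ‖φ (mulIP x (X i))‖ * (‖x t‖ * (‖X i t‖ * ‖e t‖)) := by
      rw [ZeroAtInftyContinuousMap.mul_apply, hF, c0_sum_apply, Finset.sum_mul]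
      refine (norm_sum_le _ _).trans (Finset.sum_le_sum fun i _ => le_of_eq ?_)
      simp only [ZeroAtInftyContinuousMap.smul_apply, mulIP_apply', smul_eq_mul, norm_mul,
        norm_star]
      ring
    have h2 : ∑ i ∈ s, (‖x t‖ * (‖X i t‖ * ‖e t‖)) ^ 2 ≤ R ^ 2 * D := by
      have : ∑ i ∈ s, (‖x t‖ * (‖X i t‖ * ‖e t‖)) ^ 2
          = ‖x t‖ ^ 2 * ∑ i ∈ s, ‖X i t‖ ^ 2 * ‖e t‖ ^ 2 := by
        rw [Finset.mul_sum]
        exact Finset.sum_congr rfl fun i _ => by ring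
      rw [this]
      have hxt : ‖x t‖ ≤ R := (c0_apply_le x t).trans hx
      have h3 : ‖x t‖ ^ 2 ≤ R ^ 2 := by gcongr
      exact mul_le_mul h3 (hs t) (Finset.sum_nonneg fun i _ => by positivity) (by positivity)
    calc ‖(F * e) t‖ ^ 2
        ≤ (∑ i ∈ s, ‖φ (mulIP x (X i))‖ * (‖x t‖ * (‖X i t‖ * ‖e t‖))) ^ 2 := by gcongr
      _ ≤ A * ∑ i ∈ s, (‖x t‖ * (‖X i t‖ * ‖e t‖)) ^ 2 := Finset.sum_mul_sq_le_sq_mul_sq _ _ _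
      _ ≤ A * (R ^ 2 * D) := by gcongr
  have hB : 0 ≤ A * (R ^ 2 * D) := by positivity
  have hnorm : ‖F * e‖ ≤ Real.sqrt (A * (R ^ 2 * D)) :=
    c0_norm_le _ (Real.sqrt_nonneg _) fun t => Real.le_sqrt_of_sq_le (hpt t)
  have h6 : A ≤ Real.sqrt (A * (R ^ 2 * D)) := by
    have h7 : A = ‖φ F‖ := by rw [hφF, Complex.norm_real, Real.norm_of_nonneg hA0]
    calc A = ‖φ (F * e)‖ := by rw [← he, ← h7]
      _ ≤ ‖φ‖ * ‖F * e‖ := φ.le_opNorm _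
      _ ≤ 1 * ‖F * e‖ := by gcongr
      _ ≤ _ := by rw [one_mul]; exact hnorm
  have h8 : A ^ 2 ≤ A * (R ^ 2 * D) := by
    have := pow_le_pow_left₀ hA0 h6 2
    rwa [Real.sq_sqrt hB] at this
  by_contra hlt
  push Not at hlt
  have : 0 ≤ R ^ 2 * D := by positivity
  nlinarith

/-- All states in a sequence live on a common compact set, hence have a common local unit. -/
theorem exists_common_unit {K : Type*} [TopologicalSpace K]
    [LocallyCompactSpace K] [T2Space K]
    (hcc : ∀ F : ℕ → Set K, (∀ n, IsCompact (F n)) →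
      ∃ C : Set K, IsCompact C ∧ ∀ n, F n ⊆ C)
    (φ : ℕ → (C₀(K, ℂ) →L[ℂ] ℂ)) (hφ : ∀ k, ‖φ k‖ = 1) :
    ∃ e : C₀(K, ℂ), ∀ k, ∀ F : C₀(K, ℂ), φ k F = φ k (F * e) := by
  have h1 : ∀ k n : ℕ, ∃ f : C₀(K, ℂ), ‖f‖ < 1 ∧ 1 - 1 / ((n : ℝ) + 1) < ‖φ k f‖ := by
    intro k n
    refine (φ k).exists_lt_apply_of_lt_opNorm ?_
    rw [hφ k]
    have : 0 < 1 / ((n : ℝ) + 1) := by positivity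
    linarith
  choose f hf1 hf2 using h1
  have h2 : ∀ k n m : ℕ, ∃ T : Set K, IsCompact T ∧ ∀ t ∉ T, ‖f k n t‖ < 1 / ((m : ℝ) + 1) := by
    intro k n m
    have h := (f k n).zero_at_infty'
    have h3 := h.norm
    rw [norm_zero] at h3
    have h4 := h3.eventually (gt_mem_nhds (show (0 : ℝ) < 1 / ((m : ℝ) + 1) by positivity))
    obtain ⟨T, hT, hT'⟩ := mem_cocompact.1 h4
    exact ⟨T, hT, fun t ht => hT' ht⟩
  choose T hT1 hT2 using h2
  let q := (Denumerable.eqv (ℕ × ℕ × ℕ)).symm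
  obtain ⟨C, hC, hFC⟩ := hcc (fun j => T (q j).1 (q j).2.1 (q j).2.2) (fun j => hT1 _ _ _)
  have hTC : ∀ k n m, T k n m ⊆ C := by
    intro k n m
    have := hFC (q.symm (k, n, m))
    simpa using this
  obtain ⟨g, hg1, -, hg2, -⟩ := exists_continuous_one_zero_of_isCompact hC isClosed_empty
    (Set.disjoint_empty C)
  let e : C₀(K, ℂ) :=
    { toFun := fun t => (g t : ℂ)
      continuous_toFun := Complex.continuous_ofReal.comp g.continuous
      zero_at_infty' := by
        have h : Tendsto g (cocompact K) (nhds 0) := hg2.is_zero_at_infty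
        have := (Complex.continuous_ofReal.tendsto 0).comp h
        rw [Complex.ofReal_zero] at this
        exact this }
  have he : ∀ t, e t = (g t : ℂ) := fun t => rfl
  refine ⟨e, fun k F => ?_⟩
  rw [← sub_eq_zero, ← map_sub]
  refine phi_eq_zero (φ k) (hφ k).le C (f k) (fun n => (hf1 k n).le) (hf2 k) ?_ _ ?_
  · intro n t ht
    have : ‖f k n t‖ ≤ 0 := ge_of_tendsto' tendsto_one_div_add_atTop_nhds_zero_nat
      fun m => (hT2 k n m t fun h => ht (hTC _ _ _ h)).le
    exact norm_le_zero_iff.1 this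
  · intro t ht
    have : g t = 1 := hg1 ht
    simp [he, this]

/-- Let `K` be a locally compact Hausdorff space which is not σ-compact and
such that every countable family of compact subsets of `K` is contained in a single compact
subset. Then the closed unit ball of `C₀(K)` is totally bounded with respect to every
seminorm `ν_{X,Φ}` coming from an external admissible system `X ⊆ C_b(K)` for `C₀(K)` and a
sequence `Φ` of states: for every `ε > 0` there are finitely many elements `y₁, …, yₙ` of
the unit ball such that every `x` in the unit ball satisfies `ν_{X,Φ}(x − y_j) < ε` for
some `j`. -/
theorem unitBall_totallyBounded_nuXPhi {K : Type*} [TopologicalSpace K]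
    [LocallyCompactSpace K] [T2Space K]
    (hσ : ¬ SigmaCompactSpace K)
    (hcc : ∀ F : ℕ → Set K, (∀ n, IsCompact (F n)) →
      ∃ C : Set K, IsCompact C ∧ ∀ n, F n ⊆ C)
    (X : ℕ → (K →ᵇ ℂ)) (hX : IsExternalAdmissible X)
    (φ : ℕ → (C₀(K, ℂ) →L[ℂ] ℂ)) (hφ : ∀ k, IsStateC0 (φ k))
    (ε : ℝ) (hε : 0 < ε) :
    ∃ (n : ℕ) (y : Fin n → C₀(K, ℂ)),
      (∀ j, ‖y j‖ ≤ 1) ∧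
      ∀ x : C₀(K, ℂ), ‖x‖ ≤ 1 → ∃ j, nuXPhi X φ (x - y j) < ε := by
  obtain ⟨e, he⟩ := exists_common_unit hcc φ (fun k => (hφ k).2)
  obtain ⟨g, hg, -⟩ := hX.1 e
  have hδ : 0 < ε ^ 2 / 32 := by positivity
  obtain ⟨N, hN⟩ := eventually_atTop.1 (Metric.tendstoUniformly_iff.1 hg _ hδ)
  have htail : ∀ a b, N ≤ a → a ≤ b → ∀ t,
      ∑ i ∈ Finset.Ico a b, ‖X i t‖ ^ 2 * ‖e t‖ ^ 2 ≤ ε ^ 2 / 16 := by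
    intro a b ha hab t
    rw [Finset.sum_Ico_eq_sub _ hab]
    have h1 := hN a ha t
    have h2 := hN b (ha.trans hab) t
    rw [Real.dist_eq, abs_lt] at h1 h2
    linarith [h1.1, h1.2, h2.1, h2.2]
  let T : C₀(K, ℂ) → (Fin N × Fin N → ℂ) := fun x p => φ p.1 (mulIP x (X p.2))
  have hTb : ∀ x : C₀(K, ℂ), ‖x‖ ≤ 1 → ‖T x‖ ≤ 1 := by
    intro x hx
    refine (pi_norm_le_iff_of_nonneg zero_le_one).2 fun p => ?_
    refine ((φ p.1).le_opNorm _).trans ?_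
    rw [(hφ p.1).2, one_mul]
    refine c0_norm_le _ zero_le_one fun t => ?_
    rw [mulIP_apply', norm_mul, norm_star]
    exact mul_le_one₀ ((c0_apply_le x t).trans hx) (norm_nonneg _)
      (((X p.2).norm_coe_le_norm t).trans (hX.2 _))
  have htb : TotallyBounded (T '' {x | ‖x‖ ≤ 1}) := by
    refine (isCompact_closedBall (0 : Fin N × Fin N → ℂ) 1).totallyBounded.subset ?_
    rintro _ ⟨x, hx, rfl⟩
    simpa using hTb x hx
  have hη : 0 < ε / (2 * ((N : ℝ) + 1)) := by positivity
  obtain ⟨S, hS1, hS2, hS3⟩ := Metric.finite_approx_of_totallyBounded htb _ hη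
  obtain ⟨n, z, hz⟩ : ∃ (n : ℕ) (z : Fin n → (Fin N × Fin N → ℂ)), Set.range z = S := by
    haveI := hS2.fintype
    refine ⟨Fintype.card S, fun j => ((Fintype.equivFin S).symm j : Fin N × Fin N → ℂ), ?_⟩
    ext w
    constructor
    · rintro ⟨j, rfl⟩
      exact Subtype.coe_prop _
    · intro hw
      exact ⟨Fintype.equivFin S ⟨w, hw⟩, by simp⟩
  have hzy : ∀ j, ∃ y : C₀(K, ℂ), ‖y‖ ≤ 1 ∧ T y = z j := by
    intro j
    obtain ⟨y, hy, hy'⟩ := hS1 (hz ▸ Set.mem_range_self j : z j ∈ S)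
    exact ⟨y, hy, hy'⟩
  choose y hy1 hy2 using hzy
  refine ⟨n, y, hy1, fun x hx => ?_⟩
  have hxS := hS3 ⟨x, hx, rfl⟩
  simp only [Set.mem_iUnion] at hxS
  obtain ⟨w, hwS, hw⟩ := hxS
  rw [← hz] at hwS
  obtain ⟨j, rfl⟩ := hwS
  refine ⟨j, ?_⟩
  rw [← hy2 j, mem_ball_iff_norm] at hw
  set d := x - y j with hd
  have hdn : ‖d‖ ≤ 2 := by
    refine (norm_sub_le _ _).trans ?_
    linarith [hy1 j]
  have hsmall : ∀ k i, k < N → i < N → ‖φ k (mulIP d (X i))‖ ≤ ε / (2 * ((N : ℝ) + 1)) := by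
    intro k i hk hi
    have h1 := (norm_le_pi_norm (T x - T (y j)) (⟨k, hk⟩, ⟨i, hi⟩)).trans hw.le
    have h2 : (T x - T (y j)) (⟨k, hk⟩, ⟨i, hi⟩) = φ k (mulIP d (X i)) := by
      rw [hd, mulIP_sub', map_sub]; rfl
    rwa [h2] at h1
  have htl : ∀ k a b, N ≤ a → a ≤ b →
      ∑ i ∈ Finset.Ico a b, ‖φ k (mulIP d (X i))‖ ^ 2 ≤ ε ^ 2 / 4 := by
    intro k a b ha hab
    refine (bessel_bound (φ k) (hφ k).2.le e (he k) X (Finset.Ico a b) (ε ^ 2 / 16) 2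
      (by norm_num) (by positivity) (htail a b ha hab) d hdn).trans (le_of_eq ?_)
    ring
  have hpart : ∀ k m, ∑ i ∈ Finset.range m, ‖φ k (mulIP d (X (k + i)))‖ ^ 2 ≤ ε ^ 2 / 2 := by
    intro k m
    have hre : ∑ i ∈ Finset.range m, ‖φ k (mulIP d (X (k + i)))‖ ^ 2
        = ∑ i ∈ Finset.Ico k (k + m), ‖φ k (mulIP d (X i))‖ ^ 2 := by
      rw [Finset.sum_Ico_eq_sum_range]; simp
    rw [hre]
    have hε2 : 0 < ε ^ 2 := by positivity
    rcases le_or_gt N k with hk | hk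
    · linarith [htl k k (k + m) hk (by omega)]
    · have hsub : ∑ i ∈ Finset.Ico k (k + m), ‖φ k (mulIP d (X i))‖ ^ 2
          ≤ ∑ i ∈ Finset.range N, ‖φ k (mulIP d (X i))‖ ^ 2
            + ∑ i ∈ Finset.Ico N (N + (k + m)), ‖φ k (mulIP d (X i))‖ ^ 2 := by
        rw [Finset.sum_range_add_sum_Ico _ (by omega)]
        refine Finset.sum_le_sum_of_subset_of_nonneg ?_ fun i _ _ => by positivity
        intro i hi
        simp only [Finset.mem_Ico, Finset.mem_range] at hi ⊢
        omega
      have hhead : ∑ i ∈ Finset.range N, ‖φ k (mulIP d (X i))‖ ^ 2 ≤ ε ^ 2 / 4 := by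
        calc ∑ i ∈ Finset.range N, ‖φ k (mulIP d (X i))‖ ^ 2
            ≤ ∑ i ∈ Finset.range N, (ε / (2 * ((N : ℝ) + 1))) ^ 2 := by
              refine Finset.sum_le_sum fun i hi => ?_
              have := hsmall k i hk (Finset.mem_range.1 hi)
              gcongr
          _ = N * (ε / (2 * ((N : ℝ) + 1))) ^ 2 := by simp
          _ = (N / ((N : ℝ) + 1) ^ 2) * (ε ^ 2 / 4) := by field_simp; ring
          _ ≤ 1 * (ε ^ 2 / 4) := by
              gcongr
              rw [div_le_one (by positivity)]
              have : (0 : ℝ) ≤ N := Nat.cast_nonneg N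
              nlinarith
          _ = ε ^ 2 / 4 := one_mul _
      linarith [htl k N (N + (k + m)) le_rfl (by omega)]
  unfold nuXPhi
  rw [Real.sqrt_lt' hε]
  refine lt_of_le_of_lt (ciSup_le fun k =>
    Real.tsum_le_of_sum_range_le (fun i => by positivity) (hpart k)) ?_
  have : 0 < ε ^ 2 := by positivity
  linarith
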